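/- Let b = ρΦ ∈ C¹_♯(Y_d)^d, where ρ ∈ C¹_♯(Y_d) is nonnegative, not identically zero, and vanishes at some point, and Φ ∈ C¹_♯(Y_d)^d vanishes nowhere; let (ρ_n) ⊂ C¹_♯(Y_d) be positive with ρ ≤ ρ_n, ρ_n → ρ uniformly, and with rotation set of ρ_nΦ a singleton for each n. Assume there exists a positive σ ∈ C¹_♯(Y_d) such that σΦ is divergence free in ℝ^d. If m := (∫_{Y_d} σ(y)/ρ(y) dy)^{-1} > 0 (i.e., σ/ρ is integrable), then the rotation set C_b equals the closed segment [0,ζ] := {sζ : s ∈ [0,1]} with ζ := m ∫_{Y_d} Φ(y)σ(y) dy. -/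

import Mathlib

open MeasureTheory Filter Matrix

noncomputable section

/-- A function on `ℝ^d` is `ℤ^d`-periodic. -/
def ZdPeriodic {d : ℕ} {E : Type*} (f : (Fin d → ℝ) → E) : Prop :=
  ∀ (κ : Fin d → ℤ) (x : Fin d → ℝ), f (x + fun i => (κ i : ℝ)) = f x

/-- The unit cube `[0,1)^d`, a fundamental domain for the torus `Y_d = ℝ^d/ℤ^d`. -/
def unitCube (d : ℕ) : Set (Fin d → ℝ) := {x | ∀ i, x i ∈ Set.Ico (0 : ℝ) 1}

/-- `X` is the global flow of the vector field `b`: `∂X/∂t(t,x) = b(X(t,x))`, `X(0,x) = x`. -/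
def IsFlowOf {d : ℕ} (b : (Fin d → ℝ) → (Fin d → ℝ))
    (X : ℝ → (Fin d → ℝ) → (Fin d → ℝ)) : Prop :=
  ∀ x : Fin d → ℝ, X 0 x = x ∧ ∀ t : ℝ, HasDerivAt (fun s => X s x) (b (X t x)) t

/-- A measure `μ` on the torus `Y_d` (identified with a measure on `ℝ^d` carried by the unit
cube) is invariant for the flow `X`: `∫ ψ(X(t,y)) dμ = ∫ ψ dμ` for all `t` and all continuous
`ℤ^d`-periodic `ψ`. -/
def FlowInvariant {d : ℕ} (X : ℝ → (Fin d → ℝ) → (Fin d → ℝ))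
    (μ : Measure (Fin d → ℝ)) : Prop :=
  ∀ (t : ℝ) (ψ : (Fin d → ℝ) → ℝ), Continuous ψ → ZdPeriodic ψ →
    ∫ y, ψ (X t y) ∂μ = ∫ y, ψ y ∂μ

/-- Herman's rotation set `C_b = {∫ b dμ : μ invariant probability measure for the flow}`. -/
def rotationSet {d : ℕ} (b : (Fin d → ℝ) → (Fin d → ℝ))
    (X : ℝ → (Fin d → ℝ) → (Fin d → ℝ)) : Set (Fin d → ℝ) :=
  {ζ | ∃ μ : Measure (Fin d → ℝ), IsProbabilityMeasure μ ∧ μ (unitCube d)ᶜ = 0 ∧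
        FlowInvariant X μ ∧ ζ = ∫ y, b y ∂μ}

/-- The gradient of a scalar function on `ℝ^d`. -/
def grad {d : ℕ} (ψ : (Fin d → ℝ) → ℝ) (y : Fin d → ℝ) : Fin d → ℝ :=
  fun i => fderiv ℝ ψ y (Pi.single i 1)

section Periodic

variable {d : ℕ} {E : Type*}

lemma ZdPeriodic.exists_mem_unitCube (x : Fin d → ℝ) :
    ∃ κ : Fin d → ℤ, (x + fun i => (κ i : ℝ)) ∈ unitCube d := by
  refine ⟨fun i => -⌊x i⌋, fun i => ?_⟩
  simp only [Pi.add_apply, Int.cast_neg, ← sub_eq_add_neg, Int.self_sub_floor]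
  exact ⟨Int.fract_nonneg _, Int.fract_lt_one _⟩

lemma unitCube_subset_Icc : unitCube d ⊆ Set.Icc 0 1 :=
  fun _ hx => ⟨fun i => (hx i).1, fun i => (hx i).2.le⟩

lemma ZdPeriodic.exists_bound [NormedAddCommGroup E] {f : (Fin d → ℝ) → E}
    (hf : ZdPeriodic f) (hc : Continuous f) : ∃ C : NNReal, ∀ x, ‖f x‖ ≤ C := by
  obtain ⟨C, hC⟩ := (isCompact_Icc (a := (0 : Fin d → ℝ)) (b := 1)).exists_bound_of_continuousOn
    hc.continuousOn
  refine ⟨C.toNNReal, fun x => ?_⟩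
  obtain ⟨κ, hκ⟩ := ZdPeriodic.exists_mem_unitCube x
  rw [← hf κ x]
  exact (hC _ (unitCube_subset_Icc hκ)).trans (Real.le_coe_toNNReal C)

lemma ZdPeriodic.fderiv [NormedAddCommGroup E] [NormedSpace ℝ E] {f : (Fin d → ℝ) → E}
    (hf : ZdPeriodic f) : ZdPeriodic (fderiv ℝ f) := by
  intro κ x
  rw [← fderiv_comp_add_right]
  congr 1
  exact funext (hf κ)

lemma ZdPeriodic.exists_lipschitzWith [NormedAddCommGroup E] [NormedSpace ℝ E]
    {f : (Fin d → ℝ) → E} (hf : ZdPeriodic f) (hc : ContDiff ℝ 1 f) :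
    ∃ K : NNReal, LipschitzWith K f := by
  obtain ⟨K, hK⟩ := hf.fderiv.exists_bound (hc.continuous_fderiv one_ne_zero)
  exact ⟨K, lipschitzWith_of_nnnorm_fderiv_le (hc.differentiable one_ne_zero) hK⟩

lemma measurableSet_unitCube : MeasurableSet (unitCube d) := by
  have : unitCube d = Set.univ.pi fun _ => Set.Ico (0 : ℝ) 1 := by ext; simp [unitCube]
  rw [this]
  exact MeasurableSet.univ_pi fun _ => measurableSet_Ico

lemma unitCube_ae_eq_Icc : unitCube d =ᵐ[volume] Set.Icc 0 1 := by
  have : unitCube d = Set.univ.pi fun i =>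
      Set.Ico ((0 : Fin d → ℝ) i) ((1 : Fin d → ℝ) i) := by ext; simp [unitCube]
  rw [this]
  exact Measure.univ_pi_Ico_ae_eq_Icc

end Periodic

section Flow

variable {d : ℕ} {b : (Fin d → ℝ) → (Fin d → ℝ)} {X : ℝ → (Fin d → ℝ) → (Fin d → ℝ)}
  {L M : NNReal}

lemma IsFlowOf.neg (hX : IsFlowOf b X) : IsFlowOf (fun y => -b y) (fun t => X (-t)) := by
  intro x
  refine ⟨by simpa using (hX x).1, fun t => ?_⟩
  have h := ((hX x).2 (-t)).scomp t (hasDerivAt_neg t)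
  rw [neg_one_smul] at h
  exact h

lemma IsFlowOf.continuous_time (hX : IsFlowOf b X) (x : Fin d → ℝ) :
    Continuous fun t => X t x :=
  continuous_iff_continuousAt.2 fun t => ((hX x).2 t).continuousAt

lemma IsFlowOf.dist_le (hX : IsFlowOf b X) (hb : LipschitzWith L b) {t : ℝ} (ht : 0 ≤ t)
    (x y : Fin d → ℝ) : dist (X t x) (X t y) ≤ dist x y * Real.exp (L * t) := by
  have := dist_le_of_trajectories_ODE (v := fun _ => b) (a := 0) (b := t) (δ := dist x y)
    (fun _ => hb)
    (hX.continuous_time x).continuousOn (fun s _ => ((hX x).2 s).hasDerivWithinAt)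
    (hX.continuous_time y).continuousOn (fun s _ => ((hX y).2 s).hasDerivWithinAt)
    (by rw [(hX x).1, (hX y).1]) t ⟨ht, le_rfl⟩
  simpa using this

lemma IsFlowOf.lipschitzWith (hX : IsFlowOf b X) (hb : LipschitzWith L b) {t T : ℝ}
    (ht : 0 ≤ t) (htT : t ≤ T) : LipschitzWith (Real.exp (L * T)).toNNReal (X t) := by
  refine LipschitzWith.of_dist_le_mul fun x y => ?_
  rw [Real.coe_toNNReal _ (Real.exp_pos _).le, mul_comm]
  refine (hX.dist_le hb ht x y).trans ?_
  gcongr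

lemma IsFlowOf.continuous (hX : IsFlowOf b X) (hb : LipschitzWith L b) (t : ℝ) :
    Continuous (X t) := by
  rcases le_total 0 t with ht | ht
  · exact (hX.lipschitzWith hb ht le_rfl).continuous
  · have := (hX.neg.lipschitzWith hb.neg (neg_nonneg.2 ht) le_rfl).continuous
    simpa using this

lemma IsFlowOf.eq_of_hasDerivAt (hX : IsFlowOf b X) (hb : LipschitzWith L b)
    {γ : ℝ → Fin d → ℝ} (hγ : ∀ t, HasDerivAt γ (b (γ t)) t) (t : ℝ) : γ t = X t (γ 0) := by
  have := ODE_solution_unique_univ (v := fun _ => b) (s := fun _ => Set.univ) (t₀ := 0)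
    (f := γ) (g := fun t => X t (γ 0)) (K := L) (fun _ => hb.lipschitzOnWith)
    (fun t => ⟨hγ t, trivial⟩) (fun t => ⟨(hX _).2 t, trivial⟩) (hX _).1.symm
  exact congrFun this t

lemma IsFlowOf.add_int (hX : IsFlowOf b X) (hb : LipschitzWith L b) (hper : ZdPeriodic b)
    (t : ℝ) (κ : Fin d → ℤ) (x : Fin d → ℝ) :
    X t (x + fun i => (κ i : ℝ)) = X t x + fun i => (κ i : ℝ) := by
  have := hX.eq_of_hasDerivAt hb (γ := fun t => X t x + fun i => (κ i : ℝ))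
    (fun s => by simpa [hper κ (X s x)] using ((hX x).2 s).add_const (fun i => (κ i : ℝ))) t
  simpa [(hX x).1] using this.symm

lemma IsFlowOf.add_time (hX : IsFlowOf b X) (hb : LipschitzWith L b) (s t : ℝ)
    (x : Fin d → ℝ) : X (s + t) x = X s (X t x) := by
  have := hX.eq_of_hasDerivAt hb (γ := fun s => X (s + t) x)
    (fun s => ((hX x).2 (s + t)).comp_add_const s t) s
  simpa using this

lemma ZdPeriodic.comp_flow {ψ : (Fin d → ℝ) → ℝ} (hψ : ZdPeriodic ψ) (hX : IsFlowOf b X)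
    (hb : LipschitzWith L b) (hper : ZdPeriodic b) (t : ℝ) :
    ZdPeriodic fun x => ψ (X t x) := by
  intro κ x
  simp only [hX.add_int hb hper, hψ κ]

lemma IsFlowOf.norm_sub_le (hX : IsFlowOf b X) (hM : ∀ x, ‖b x‖ ≤ M) {h : ℝ} (hh : 0 ≤ h)
    (x : Fin d → ℝ) : ‖X h x - x‖ ≤ M * h := by
  have := norm_image_sub_le_of_norm_deriv_le_segment' (f := fun t => X t x) (a := 0) (b := h)
    (fun s _ => ((hX x).2 s).hasDerivWithinAt) (fun s _ => hM _) h ⟨hh, le_rfl⟩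
  simpa [(hX x).1] using this

lemma IsFlowOf.norm_sub_sub_le (hX : IsFlowOf b X) (hb : LipschitzWith L b)
    (hM : ∀ x, ‖b x‖ ≤ M) {h : ℝ} (hh : 0 ≤ h) (x : Fin d → ℝ) :
    ‖X h x - x - h • b x‖ ≤ L * M * h ^ 2 := by
  have := norm_image_sub_le_of_norm_deriv_le_segment' (f := fun t => X t x - t • b x)
    (a := 0) (b := h) (C := L * (M * h)) (f' := fun t => b (X t x) - (1 : ℝ) • b x)
    (fun s _ => (((hX x).2 s).sub ((hasDerivAt_id s).smul_const (b x))).hasDerivWithinAt)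
    (fun s hs => by
      rw [one_smul, ← dist_eq_norm]
      refine (hb.dist_le_mul _ _).trans ?_
      rw [dist_eq_norm]
      have := hX.norm_sub_le hM hs.1 x
      have := hs.2.le
      gcongr
      refine ‹‖X s x - x‖ ≤ M * s›.trans ?_
      gcongr) h ⟨hh, le_rfl⟩
  simp only [(hX x).1, zero_smul, sub_zero] at this
  rw [sub_right_comm]
  exact this.trans (le_of_eq (by ring))

lemma IsFlowOf.norm_displacement_sub_le (hX : IsFlowOf b X) (hb : LipschitzWith L b)
    {h T : ℝ} (hh : 0 ≤ h) (hT : h ≤ T) (x y : Fin d → ℝ) :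
    ‖X h x - X h y - (x - y)‖ ≤ L * Real.exp (L * T) * ‖x - y‖ * h := by
  have := norm_image_sub_le_of_norm_deriv_le_segment' (f := fun t => X t x - X t y)
    (a := 0) (b := h) (C := L * Real.exp (L * T) * ‖x - y‖)
    (fun s _ => (((hX x).2 s).sub ((hX y).2 s)).hasDerivWithinAt)
    (fun s hs => by
      rw [← dist_eq_norm]
      refine (hb.dist_le_mul _ _).trans ?_
      rw [mul_assoc, ← dist_eq_norm]
      have := (hX.lipschitzWith hb hs.1 (hs.2.le.trans hT)).dist_le_mul x y
      rw [Real.coe_toNNReal _ (Real.exp_pos _).le] at this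
      gcongr) h ⟨hh, le_rfl⟩
  simpa [(hX x).1, (hX y).1] using this

end Flow

section Mollify

variable {d : ℕ}

/-- Convolution of `u` with a smooth bump function. -/
def mollify (φ : ContDiffBump (0 : Fin d → ℝ)) (u : (Fin d → ℝ) → ℝ) : (Fin d → ℝ) → ℝ :=
  convolution (φ.normed volume) u (ContinuousLinearMap.lsmul ℝ ℝ) volume

variable {φ : ContDiffBump (0 : Fin d → ℝ)} {u v : (Fin d → ℝ) → ℝ}

lemma mollify_apply (x : Fin d → ℝ) :
    mollify φ u x = ∫ z, φ.normed volume z * u (x - z) := rfl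

lemma integrable_mollify (hu : Continuous u) (x : Fin d → ℝ) :
    Integrable fun z => φ.normed volume z * u (x - z) :=
  φ.hasCompactSupport_normed.convolutionExists_left (ContinuousLinearMap.lsmul ℝ ℝ)
    φ.continuous_normed hu.locallyIntegrable x

lemma ZdPeriodic.mollify (hu : ZdPeriodic u) : ZdPeriodic (mollify φ u) := by
  intro κ x
  simp only [mollify_apply, add_sub_right_comm, hu κ]

lemma contDiff_mollify (hu : Continuous u) : ContDiff ℝ 1 (mollify φ u) :=
  φ.hasCompactSupport_normed.contDiff_convolution_left (n := 1) _ φ.contDiff_normed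
    hu.locallyIntegrable

lemma abs_integral_normed_mul_le {f : (Fin d → ℝ) → ℝ} {C : ℝ}
    (hf : ∀ z, ‖z‖ ≤ φ.rOut → |f z| ≤ C) : |∫ z, φ.normed volume z * f z| ≤ C := by
  have h : ∀ z, ‖φ.normed volume z * f z‖ ≤ φ.normed volume z * C := by
    intro z
    rw [norm_mul, Real.norm_of_nonneg (φ.nonneg_normed z)]
    by_cases hz : z ∈ Metric.ball (0 : Fin d → ℝ) φ.rOut
    · exact mul_le_mul_of_nonneg_left (hf z (mem_ball_zero_iff.1 hz).le) (φ.nonneg_normed z)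
    · rw [← φ.support_normed_eq (μ := volume), Function.notMem_support] at hz
      simp [hz]
  refine (norm_integral_le_of_norm_le (φ.integrable_normed.mul_const C) (.of_forall h)).trans ?_
  rw [integral_mul_const, φ.integral_normed, one_mul]

lemma abs_mollify_sub_le (hu : Continuous u) (hv : Continuous v) {C : ℝ} {x y : Fin d → ℝ}
    (h : ∀ z, ‖z‖ ≤ φ.rOut → |u (x - z) - v (y - z)| ≤ C) :
    |mollify φ u x - mollify φ v y| ≤ C := by
  rw [mollify_apply, mollify_apply, ← integral_sub (integrable_mollify hu x)
    (integrable_mollify hv y)]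
  simp only [← mul_sub]
  exact abs_integral_normed_mul_le h

lemma abs_mollify_le {C : ℝ} (h : ∀ x, |u x| ≤ C) (x : Fin d → ℝ) : |mollify φ u x| ≤ C :=
  abs_integral_normed_mul_le fun _ _ => h _

lemma LipschitzWith.mollify {K : NNReal} (hu : LipschitzWith K u) :
    LipschitzWith K (mollify φ u) := by
  refine LipschitzWith.of_dist_le_mul fun x y => ?_
  refine abs_mollify_sub_le hu.continuous hu.continuous fun z _ => ?_
  simpa [Real.dist_eq] using hu.dist_le_mul (x - z) (y - z)

lemma abs_mollify_sub_self_le {K : NNReal} (hu : LipschitzWith K u) (x : Fin d → ℝ) :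
    |mollify φ u x - u x| ≤ K * φ.rOut := by
  refine ContDiffBump.dist_normed_convolution_le hu.continuous.aestronglyMeasurable fun y hy => ?_
  exact (hu.dist_le_mul _ _).trans (mul_le_mul_of_nonneg_left (Metric.mem_ball.1 hy).le K.2)

lemma exists_lipschitz_fderiv_mollify (φ : ContDiffBump (0 : Fin d → ℝ)) :
    ∃ A : ℝ, 0 ≤ A ∧ ∀ (u : (Fin d → ℝ) → ℝ) (K : NNReal), LipschitzWith K u → ∀ x y,
      ‖fderiv ℝ (mollify φ u) x - fderiv ℝ (mollify φ u) y‖ ≤ A * K * ‖x - y‖ := by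
  set η : (Fin d → ℝ) → ℝ := φ.normed volume
  set B := ContinuousLinearMap.precompL (Fin d → ℝ) (ContinuousLinearMap.lsmul ℝ ℝ (E := ℝ))
  have hη : ContDiff ℝ 1 η := φ.contDiff_normed
  have hη' : Continuous (fderiv ℝ η) := hη.continuous_fderiv one_ne_zero
  have hs : HasCompactSupport (fderiv ℝ η) := φ.hasCompactSupport_normed.fderiv ℝ
  have hB : ∀ f c, B f c = c • f := fun f c => by
    ext v
    simp [B, mul_comm]
  refine ⟨∫ z, ‖fderiv ℝ η z‖, integral_nonneg fun _ => norm_nonneg _, fun u K hu x y => ?_⟩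
  have hd : ∀ x, fderiv ℝ (mollify φ u) x = ∫ z, B (fderiv ℝ η z) (u (x - z)) := fun x =>
    (φ.hasCompactSupport_normed.hasFDerivAt_convolution_left _ hη
      hu.continuous.locallyIntegrable x).fderiv
  have hi : ∀ x, Integrable fun z => B (fderiv ℝ η z) (u (x - z)) := fun x =>
    hs.convolutionExists_left B hη' hu.continuous.locallyIntegrable x
  rw [hd, hd, ← integral_sub (hi x) (hi y)]
  refine (norm_integral_le_of_norm_le (g := fun z => ‖fderiv ℝ η z‖ * (K * ‖x - y‖))
    ?_ (.of_forall fun z => ?_)).trans ?_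
  · exact ((hη'.integrable_of_hasCompactSupport hs).norm).mul_const _
  · rw [hB, hB, ← sub_smul, norm_smul, mul_comm]
    gcongr
    simpa [Real.dist_eq, dist_eq_norm] using hu.dist_le_mul (x - z) (y - z)
  · rw [integral_mul_const, mul_assoc _ (K : ℝ)]

lemma exists_mollify_taylor (φ : ContDiffBump (0 : Fin d → ℝ)) :
    ∃ A : ℝ, 0 ≤ A ∧ ∀ (u : (Fin d → ℝ) → ℝ) (K : NNReal), LipschitzWith K u → ∀ x y,
      |mollify φ u y - mollify φ u x - fderiv ℝ (mollify φ u) x (y - x)|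
        ≤ A * K * ‖y - x‖ ^ 2 := by
  obtain ⟨A, hA, h⟩ := exists_lipschitz_fderiv_mollify φ
  refine ⟨A, hA, fun u K hu x y => ?_⟩
  have := Convex.norm_image_sub_le_of_norm_hasFDerivWithin_le' (f := mollify φ u)
    (s := segment ℝ x y) (C := A * K * ‖y - x‖) (f' := fderiv ℝ (mollify φ u))
    (φ := fderiv ℝ (mollify φ u) x) (x := x) (y := y)
    (fun z _ => ((contDiff_mollify hu.continuous).differentiable one_ne_zero
      z).hasFDerivAt.hasFDerivWithinAt)
    (fun z hz => (h u K hu z x).trans (by gcongr; exact norm_sub_le_of_mem_segment hz))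
    (convex_segment x y) (left_mem_segment ℝ x y) (right_mem_segment ℝ x y)
  rwa [mul_assoc _ ‖y - x‖, ← sq] at this

end Mollify

section WeakInvariance

variable {d : ℕ} {b : (Fin d → ℝ) → (Fin d → ℝ)} {X : ℝ → (Fin d → ℝ) → (Fin d → ℝ)}
  {L M : NNReal} {μ : Measure (Fin d → ℝ)}

/-- The measure `b μ` is divergence free on the torus, in the sense of distributions. -/
def WeaklyDivFree (b : (Fin d → ℝ) → (Fin d → ℝ)) (μ : Measure (Fin d → ℝ)) : Prop :=
  ∀ ψ : (Fin d → ℝ) → ℝ, ContDiff ℝ 1 ψ → ZdPeriodic ψ → ∫ y, fderiv ℝ ψ y (b y) ∂μ = 0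

lemma FlowInvariant.weaklyDivFree [IsFiniteMeasure μ] (hμ : FlowInvariant X μ)
    (hX : IsFlowOf b X) (hb : LipschitzWith L b) (hM : ∀ x, ‖b x‖ ≤ M) :
    WeaklyDivFree b μ := by
  intro ψ hψ hper
  obtain ⟨C, hC⟩ := hper.exists_bound hψ.continuous
  obtain ⟨D, hD⟩ := hper.fderiv.exists_bound (hψ.continuous_fderiv one_ne_zero)
  have hψ' := hψ.continuous_fderiv one_ne_zero
  have key := hasDerivAt_integral_of_dominated_loc_of_deriv_le (μ := μ)
    (F := fun t y => ψ (X t y)) (F' := fun t y => fderiv ℝ ψ (X t y) (b (X t y)))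
    (bound := fun _ => (D : ℝ) * M) (x₀ := (0 : ℝ)) (s := Set.univ) univ_mem
    (.of_forall fun t => (hψ.continuous.comp (hX.continuous hb t)).aestronglyMeasurable)
    (Integrable.of_bound (hψ.continuous.comp (hX.continuous hb 0)).aestronglyMeasurable C
      (.of_forall fun _ => hC _))
    ((hψ'.comp (hX.continuous hb 0)).clm_apply
      (hb.continuous.comp (hX.continuous hb 0))).aestronglyMeasurable
    (.of_forall fun y t _ => (ContinuousLinearMap.le_opNorm _ _).trans
      (mul_le_mul (hD _) (hM _) (norm_nonneg _) D.2))
    (integrable_const _)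
    (.of_forall fun y t _ =>
      (hψ.differentiable one_ne_zero (X t y)).hasFDerivAt.comp_hasDerivAt t ((hX y).2 t))
  have hconst : (fun t => ∫ y, ψ (X t y) ∂μ) = fun _ => ∫ y, ψ y ∂μ :=
    funext fun t => hμ t ψ hψ.continuous hper
  have h := key.2
  rw [hconst] at h
  simpa [(hX _).1] using h.unique (hasDerivAt_const _ _)

lemma abs_sub_le_of_forall_step {G : ℝ → ℝ} {T a c : ℝ} (hT : 0 ≤ T)
    (h : ∀ t s, 0 ≤ t → t ≤ T → 0 ≤ s → s ≤ T → |G (t + s) - G t| ≤ a * s + c * s ^ 2) :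
    |G T - G 0| ≤ a * T := by
  have hN : ∀ N : ℕ, |G T - G 0| ≤ a * T + c * T ^ 2 * (1 / ((N : ℝ) + 1)) := by
    intro N
    set s := T / (N + 1) with hs
    have hs0 : 0 ≤ s := by positivity
    have hNs : ((N + 1 : ℕ) : ℝ) * s = T := by rw [hs]; push_cast; field_simp
    have hsT : s ≤ T := div_le_self hT (by linarith [N.cast_nonneg (α := ℝ)])
    have hk : ∀ k : ℕ, k ≤ N + 1 → |G (k * s) - G 0| ≤ k * (a * s + c * s ^ 2) := by
      intro k
      induction k with
      | zero => simp
      | succ k ih =>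
        intro hkN
        have h1 := ih (by omega)
        have hkT : (k : ℝ) * s ≤ T := by
          rw [← hNs]; gcongr; omega
        have h2 := h (k * s) s (by positivity) hkT hs0 hsT
        have h3 : ((k + 1 : ℕ) : ℝ) * s = k * s + s := by push_cast; ring
        rw [h3]
        refine (abs_sub_le _ (G (k * s)) _).trans ((add_le_add h2 h1).trans (le_of_eq ?_))
        push_cast
        ring
    have := hk (N + 1) le_rfl
    rw [hNs] at this
    refine this.trans (le_of_eq ?_)
    rw [mul_add, mul_left_comm, hNs, mul_left_comm, sq, ← mul_assoc _ s s, hNs, hs]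
    ring
  have hlim : Tendsto (fun N : ℕ => a * T + c * T ^ 2 * (1 / ((N : ℝ) + 1))) atTop
      (nhds (a * T + c * T ^ 2 * 0)) :=
    (tendsto_one_div_add_atTop_nhds_zero_nat.const_mul _).const_add _
  simpa using ge_of_tendsto' hlim hN

lemma ZdPeriodic.integrable [IsFiniteMeasure μ] {E : Type*} [NormedAddCommGroup E]
    [SecondCountableTopology E] {f : (Fin d → ℝ) → E} (hper : ZdPeriodic f)
    (hf : Continuous f) : Integrable f μ := by
  obtain ⟨C, hC⟩ := hper.exists_bound hf
  exact .of_bound hf.aestronglyMeasurable C (.of_forall hC)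

lemma ZdPeriodic.fderiv_apply (hper : ZdPeriodic b) {ψ : (Fin d → ℝ) → ℝ}
    (hψ : ZdPeriodic ψ) : ZdPeriodic fun y => _root_.fderiv ℝ ψ y (b y) := by
  intro κ x
  simp only [hψ.fderiv κ x, hper κ x]

lemma WeaklyDivFree.abs_integral_mollify_le [IsProbabilityMeasure μ]
    (hμ : WeaklyDivFree b μ) (hX : IsFlowOf b X) (hb : LipschitzWith L b)
    (hM : ∀ x, ‖b x‖ ≤ M) (hper : ZdPeriodic b) {ψ : (Fin d → ℝ) → ℝ} {K : NNReal}
    (hψ : LipschitzWith K ψ) (hψper : ZdPeriodic ψ) {T : ℝ} (hT : 0 ≤ T)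
    (φ : ContDiffBump (0 : Fin d → ℝ)) :
    |∫ x, mollify φ (fun y => ψ (X T y)) x ∂μ - ∫ x, mollify φ (fun y => ψ (X 0 y)) x ∂μ|
      ≤ K * Real.exp (L * T) * (L * Real.exp (L * T)) * φ.rOut * T := by
  obtain ⟨A, hA, hTaylor⟩ := exists_mollify_taylor φ
  set K' : NNReal := K * (Real.exp (L * T)).toNNReal
  have hK' : (K' : ℝ) = K * Real.exp (L * T) := by
    simp [K', Real.coe_toNNReal _ (Real.exp_pos _).le]
  refine abs_sub_le_of_forall_step (G := fun t => ∫ x, mollify φ (fun y => ψ (X t y)) x ∂μ)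
    (c := A * K' * M ^ 2 + K' * (L * M)) hT fun t s ht htT hs hsT => ?_
  set u := fun y => ψ (X t y)
  set w := fun y => ψ (X (t + s) y)
  have hu : LipschitzWith K' u := hψ.comp (hX.lipschitzWith hb ht htT)
  have huper : ZdPeriodic u := hψper.comp_flow hX hb hper t
  have hwper : ZdPeriodic w := hψper.comp_flow hX hb hper (t + s)
  have hw : Continuous w := hψ.continuous.comp (hX.continuous hb _)
  have hRu := contDiff_mollify (φ := φ) hu.continuous
  have hRw := contDiff_mollify (φ := φ) hw
  have hbd : ∀ x, ‖mollify φ w x - mollify φ u x - s * fderiv ℝ (mollify φ u) x (b x)‖ ≤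
      K * Real.exp (L * T) * (L * Real.exp (L * T)) * φ.rOut * s +
        (A * K' * M ^ 2 + K' * (L * M)) * s ^ 2 := by
    intro x
    have h1 : |mollify φ w x - mollify φ u (X s x)| ≤
        K * Real.exp (L * T) * (L * Real.exp (L * T)) * φ.rOut * s := by
      refine abs_mollify_sub_le hw hu.continuous fun z hz => ?_
      have e1 : w (x - z) = u (X s (x - z)) := by simp only [w, u, hX.add_time hb t s]
      rw [e1]
      refine (hu.dist_le_mul _ _).trans ?_
      have e2 := hX.norm_displacement_sub_le hb hs hsT (x - z) x
      have e3 : dist (X s (x - z)) (X s x - z) = ‖X s (x - z) - X s x - (x - z - x)‖ := by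
        rw [dist_eq_norm]; congr 1; abel
      rw [sub_sub_cancel_left, norm_neg] at e2
      rw [e3, sub_sub_cancel_left, hK', mul_assoc _ φ.rOut, mul_assoc _ (_ * _)]
      gcongr
      refine e2.trans ?_
      rw [mul_assoc]
      gcongr
    have h2 := hTaylor u K' hu x (X s x)
    have h3 := hX.norm_sub_le hM hs x
    have h4 : |fderiv ℝ (mollify φ u) x (X s x - x) - s * fderiv ℝ (mollify φ u) x (b x)| ≤
        K' * (L * M * s ^ 2) := by
      rw [← smul_eq_mul, ← ContinuousLinearMap.map_smul, ← ContinuousLinearMap.map_sub]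
      refine ((fderiv ℝ (mollify φ u) x).le_opNorm _).trans ?_
      exact mul_le_mul (norm_fderiv_le_of_lipschitz ℝ hu.mollify)
        (hX.norm_sub_sub_le hb hM hs x) (norm_nonneg _) K'.2
    have h5 : A * K' * ‖X s x - x‖ ^ 2 ≤ A * K' * (M * s) ^ 2 := by gcongr
    rw [Real.norm_eq_abs]
    have := abs_le.1 h1
    have := abs_le.1 h2
    have := abs_le.1 h4
    rw [abs_le]
    constructor <;> nlinarith
  have hint := norm_integral_le_of_norm_le_const (μ := μ) (.of_forall hbd)
  have iw : Integrable (mollify φ w) μ :=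
    hwper.mollify.integrable hRw.continuous
  have iu : Integrable (mollify φ u) μ :=
    huper.mollify.integrable hRu.continuous
  have id : Integrable (fun x => s * fderiv ℝ (mollify φ u) x (b x)) μ :=
    ((hper.fderiv_apply huper.mollify).integrable
      ((hRu.continuous_fderiv one_ne_zero).clm_apply hb.continuous)).const_mul s
  have hi := integral_sub (iw.sub iu) id
  simp only [Pi.sub_apply] at hi
  rw [hi, integral_sub iw iu, integral_const_mul,
    hμ _ hRu huper.mollify] at hint
  simpa using hint

lemma WeaklyDivFree.integral_comp_flow_of_lipschitz [IsProbabilityMeasure μ]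
    (hμ : WeaklyDivFree b μ) (hX : IsFlowOf b X) (hb : LipschitzWith L b)
    (hM : ∀ x, ‖b x‖ ≤ M) (hper : ZdPeriodic b) {ψ : (Fin d → ℝ) → ℝ} {K : NNReal}
    (hψ : LipschitzWith K ψ) (hψper : ZdPeriodic ψ) {T : ℝ} (hT : 0 ≤ T) :
    ∫ y, ψ (X T y) ∂μ = ∫ y, ψ y ∂μ := by
  set K' : NNReal := K * (Real.exp (L * T)).toNNReal
  have happrox : ∀ φ : ContDiffBump (0 : Fin d → ℝ), ∀ t, 0 ≤ t → t ≤ T →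
      |∫ x, mollify φ (fun y => ψ (X t y)) x ∂μ - ∫ y, ψ (X t y) ∂μ| ≤ K' * φ.rOut := by
    intro φ t ht htT
    have hu : LipschitzWith K' (fun y => ψ (X t y)) := hψ.comp (hX.lipschitzWith hb ht htT)
    have huper : ZdPeriodic (fun y => ψ (X t y)) := hψper.comp_flow hX hb hper t
    rw [← integral_sub (huper.mollify.integrable
      (contDiff_mollify hu.continuous).continuous) (huper.integrable hu.continuous)]
    have := norm_integral_le_of_norm_le_const (μ := μ)
      (f := fun x => mollify φ (fun y => ψ (X t y)) x - ψ (X t x))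
      (.of_forall fun x => abs_mollify_sub_self_le (φ := φ) hu x)
    simpa using this
  have hmain : ∀ ε > 0, |∫ y, ψ (X T y) ∂μ - ∫ y, ψ (X 0 y) ∂μ| ≤
      (2 * K' + K * Real.exp (L * T) * (L * Real.exp (L * T)) * T) * ε := by
    intro ε hε
    let φ : ContDiffBump (0 : Fin d → ℝ) := ⟨ε / 2, ε, by positivity, by linarith⟩
    have h1 := abs_le.1 (happrox φ T hT le_rfl)
    have h2 := abs_le.1 (happrox φ 0 le_rfl hT)
    have h3 := abs_le.1 (hμ.abs_integral_mollify_le hX hb hM hper hψ hψper hT φ)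
    have hφ : φ.rOut = ε := rfl
    rw [hφ] at h1 h2 h3
    rw [abs_le]
    constructor <;> linarith
  have hlim : Tendsto
      (fun n : ℕ => (2 * K' + K * Real.exp (L * T) * (L * Real.exp (L * T)) * T) *
        (1 / ((n : ℝ) + 1))) atTop (nhds 0) := by
    simpa using tendsto_one_div_add_atTop_nhds_zero_nat.const_mul
      (2 * K' + K * Real.exp (L * T) * (L * Real.exp (L * T)) * T)
  have h0 : |∫ y, ψ (X T y) ∂μ - ∫ y, ψ (X 0 y) ∂μ| ≤ 0 :=
    ge_of_tendsto' hlim fun n => hmain _ (by positivity)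
  simpa [(hX _).1] using sub_eq_zero.1 (abs_nonpos_iff.1 h0)

lemma WeaklyDivFree.flowInvariant [IsProbabilityMeasure μ]
    (hμ : WeaklyDivFree b μ) (hX : IsFlowOf b X) (hb : LipschitzWith L b)
    (hM : ∀ x, ‖b x‖ ≤ M) (hper : ZdPeriodic b) : FlowInvariant X μ := by
  have hpos : ∀ t, 0 ≤ t → ∀ ψ : (Fin d → ℝ) → ℝ, Continuous ψ → ZdPeriodic ψ →
      ∫ y, ψ (X t y) ∂μ = ∫ y, ψ y ∂μ := by
    intro t ht ψ hψ hψper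
    obtain ⟨C, hC⟩ := hψper.exists_bound hψ
    let φ : ℕ → ContDiffBump (0 : Fin d → ℝ) := fun n =>
      ⟨1 / ((n : ℝ) + 1) / 2, 1 / ((n : ℝ) + 1), by positivity, half_lt_self (by positivity)⟩
    have hφ : Tendsto (fun n => (φ n).rOut) atTop (nhds 0) :=
      tendsto_one_div_add_atTop_nhds_zero_nat
    have hlim : ∀ Y : (Fin d → ℝ) → (Fin d → ℝ), Continuous Y →
        Tendsto (fun n => ∫ y, mollify (φ n) ψ (Y y) ∂μ) atTop (nhds (∫ y, ψ (Y y) ∂μ)) := by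
      intro Y hY
      refine tendsto_integral_of_dominated_convergence (fun _ => (C : ℝ))
        (fun n => ((contDiff_mollify hψ).continuous.comp hY).aestronglyMeasurable)
        (integrable_const _) (fun n => .of_forall fun y => abs_mollify_le hC _)
        (.of_forall fun y => ?_)
      exact ContDiffBump.convolution_tendsto_right_of_continuous hφ hψ (Y y)
    refine tendsto_nhds_unique (hlim _ (hX.continuous hb t)) ?_
    refine (hlim _ continuous_id).congr fun n => ?_
    obtain ⟨K, hK⟩ := hψper.mollify.exists_lipschitzWith (contDiff_mollify (φ := φ n) hψ)
    exact (hμ.integral_comp_flow_of_lipschitz hX hb hM hper hK hψper.mollify ht).symm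
  intro t ψ hψ hψper
  rcases le_total 0 t with ht | ht
  · exact hpos t ht ψ hψ hψper
  · have := hpos (-t) (neg_nonneg.2 ht) (fun y => ψ (X t y))
      (hψ.comp (hX.continuous hb t)) (hψper.comp_flow hX hb hper t)
    rw [← this]
    simp only [← hX.add_time hb, add_neg_cancel, (hX _).1]

end WeakInvariance

section Divergence

variable {d : ℕ}

lemma integral_unitCube_divergence_eq_zero (hd : 1 ≤ d) {F : (Fin d → ℝ) → (Fin d → ℝ)}
    (hF : ContDiff ℝ 1 F) (hper : ZdPeriodic F) :
    ∫ y in unitCube d, ∑ i, fderiv ℝ (fun z => F z i) y (Pi.single i 1) = 0 := by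
  obtain ⟨n, rfl⟩ : ∃ n, d = n + 1 := ⟨d - 1, by omega⟩
  have hFi : ∀ i, ContDiff ℝ 1 fun z => F z i := fun i => (contDiff_pi.1 hF) i
  have hcont : Continuous fun y => ∑ i, fderiv ℝ (fun z => F z i) y (Pi.single i 1) :=
    continuous_finsetSum _ fun i _ =>
      ((hFi i).continuous_fderiv one_ne_zero).clm_apply continuous_const
  rw [setIntegral_congr_set unitCube_ae_eq_Icc,
    integral_divergence_of_hasFDerivAt_off_countable' 0 1 zero_le_one (fun i z => F z i)
      (fun i => fderiv ℝ fun z => F z i) ∅ Set.countable_empty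
      (fun i => (hFi i).continuous.continuousOn)
      (fun x _ i => ((hFi i).differentiable one_ne_zero x).hasFDerivAt)
      (hcont.continuousOn.integrableOn_compact isCompact_Icc)]
  refine Finset.sum_eq_zero fun i _ => sub_eq_zero.2 ?_
  congr 1
  funext x
  have hx : (i.insertNth ((1 : Fin (n + 1) → ℝ) i) x : Fin (n + 1) → ℝ) =
      (i.insertNth ((0 : Fin (n + 1) → ℝ) i) x : Fin (n + 1) → ℝ) +
        fun j => (((Pi.single i 1 : Fin (n + 1) → ℤ) j : ℤ) : ℝ) := by
    funext j
    refine Fin.succAboveCases i ?_ (fun k => ?_) j <;> simp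
  rw [hx, hper]

lemma integral_unitCube_fderiv_smul_eq_zero (hd : 1 ≤ d)
    {Φ : (Fin d → ℝ) → (Fin d → ℝ)} (hΦ : ContDiff ℝ 1 Φ) (hΦper : ZdPeriodic Φ)
    {σ : (Fin d → ℝ) → ℝ} (hσ : ContDiff ℝ 1 σ) (hσper : ZdPeriodic σ)
    (hdiv : ∀ y : Fin d → ℝ,
      ∑ i : Fin d, fderiv ℝ (fun z => σ z * Φ z i) y (Pi.single i 1) = 0)
    {ψ : (Fin d → ℝ) → ℝ} (hψ : ContDiff ℝ 1 ψ) (hψper : ZdPeriodic ψ) :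
    ∫ y in unitCube d, σ y * fderiv ℝ ψ y (Φ y) = 0 := by
  have h := integral_unitCube_divergence_eq_zero hd (F := fun y => ψ y • σ y • Φ y)
    (hψ.smul (hσ.smul hΦ)) (fun κ x => by simp only [hψper κ x, hσper κ x, hΦper κ x])
  rw [← h]
  congr 1
  funext y
  have hΦi : ∀ i, DifferentiableAt ℝ (fun z => σ z * Φ z i) y := fun i =>
    (hσ.mul (contDiff_pi.1 hΦ i)).differentiable one_ne_zero y
  have hprod : ∀ i, fderiv ℝ (fun z => (ψ z • σ z • Φ z) i) y (Pi.single i 1) =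
      ψ y * fderiv ℝ (fun z => σ z * Φ z i) y (Pi.single i 1) +
        σ y * (Φ y i * fderiv ℝ ψ y (Pi.single i 1)) := by
    intro i
    have := fderiv_fun_mul (hψ.differentiable one_ne_zero y) (hΦi i)
    simp only [Pi.smul_apply, smul_eq_mul]
    rw [this]
    simp [mul_assoc]
  simp only [hprod]
  rw [Finset.sum_add_distrib, ← Finset.mul_sum, hdiv y, mul_zero, zero_add, ← Finset.mul_sum]
  congr 1
  conv_lhs => rw [pi_eq_sum_univ' (Φ y)]
  simp [map_sum]

end Divergence

section RotationSet

variable {d : ℕ} {b : (Fin d → ℝ) → (Fin d → ℝ)} {X : ℝ → (Fin d → ℝ) → (Fin d → ℝ)}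
  {Φ : (Fin d → ℝ) → (Fin d → ℝ)} {ρ : (Fin d → ℝ) → ℝ} {μ : Measure (Fin d → ℝ)}

lemma mem_rotationSet_iff (hb : ContDiff ℝ 1 b) (hper : ZdPeriodic b) (hX : IsFlowOf b X)
    {ζ : Fin d → ℝ} :
    ζ ∈ rotationSet b X ↔ ∃ μ : Measure (Fin d → ℝ), IsProbabilityMeasure μ ∧
      μ (unitCube d)ᶜ = 0 ∧ WeaklyDivFree b μ ∧ ζ = ∫ y, b y ∂μ := by
  obtain ⟨L, hL⟩ := hper.exists_lipschitzWith hb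
  obtain ⟨M, hM⟩ := hper.exists_bound hb.continuous
  constructor
  · rintro ⟨μ, hμ, hc, hinv, rfl⟩
    exact ⟨μ, hμ, hc, hinv.weaklyDivFree hX hL hM, rfl⟩
  · rintro ⟨μ, hμ, hc, hdiv, rfl⟩
    exact ⟨μ, hμ, hc, hdiv.flowInvariant hX hL hM hper, rfl⟩

lemma convex_rotationSet (hb : ContDiff ℝ 1 b) (hper : ZdPeriodic b) (hX : IsFlowOf b X) :
    Convex ℝ (rotationSet b X) := by
  intro x hx y hy s t hs ht hst
  rw [mem_rotationSet_iff hb hper hX] at hx hy ⊢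
  obtain ⟨μ, hμ, hμc, hμd, rfl⟩ := hx
  obtain ⟨ν, hν, hνc, hνd, rfl⟩ := hy
  have hint : ∀ {E : Type} [NormedAddCommGroup E] [NormedSpace ℝ E] [SecondCountableTopology E]
      (f : (Fin d → ℝ) → E), Continuous f → ZdPeriodic f →
      ∫ y, f y ∂(ENNReal.ofReal s • μ + ENNReal.ofReal t • ν) =
        s • ∫ y, f y ∂μ + t • ∫ y, f y ∂ν := by
    intro E _ _ _ f hf hfp
    rw [integral_add_measure ((hfp.integrable hf).smul_measure ENNReal.ofReal_ne_top)
      ((hfp.integrable hf).smul_measure ENNReal.ofReal_ne_top), integral_smul_measure,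
      integral_smul_measure, ENNReal.toReal_ofReal hs, ENNReal.toReal_ofReal ht]
  refine ⟨ENNReal.ofReal s • μ + ENNReal.ofReal t • ν, ⟨?_⟩, ?_, fun ψ hψ hψp => ?_, ?_⟩
  · simp [← ENNReal.ofReal_add hs ht, hst]
  · simp [hμc, hνc]
  · rw [hint _ ((hψ.continuous_fderiv one_ne_zero).clm_apply hb.continuous)
      (hper.fderiv_apply hψp), hμd ψ hψ hψp, hνd ψ hψ hψp]
    simp
  · exact (hint b hb.continuous hper).symm

lemma zero_mem_rotationSet (hb : ContDiff ℝ 1 b) (hper : ZdPeriodic b) (hX : IsFlowOf b X)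
    (hvan : ∃ x, b x = 0) : 0 ∈ rotationSet b X := by
  obtain ⟨x, hx⟩ := hvan
  obtain ⟨κ, hκ⟩ := ZdPeriodic.exists_mem_unitCube x
  rw [← hper κ x] at hx
  rw [mem_rotationSet_iff hb hper hX]
  refine ⟨Measure.dirac (x + fun i => (κ i : ℝ)), Measure.dirac.isProbabilityMeasure, ?_, fun ψ _ _ => ?_, ?_⟩
  · rw [Measure.dirac_apply' _ measurableSet_unitCube.compl]
    simpa using hκ
  · simp [integral_dirac, hx]
  · simp [integral_dirac, hx]

/-- Change of time: an invariant measure for `ρ • Φ`, reweighted by `ρ / ρ'`, is invariant for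
`ρ' • Φ`. -/
lemma integral_eq_smul_of_rotationSet_eq_singleton [IsProbabilityMeasure μ]
    (hc : μ (unitCube d)ᶜ = 0)
    (hρ : Continuous ρ) (hρper : ZdPeriodic ρ) (hρ0 : ∀ y, 0 ≤ ρ y)
    (hΦ : ContDiff ℝ 1 Φ) (hΦper : ZdPeriodic Φ)
    (hμ : WeaklyDivFree (fun y => ρ y • Φ y) μ)
    {ρ' : (Fin d → ℝ) → ℝ} (hρ' : ContDiff ℝ 1 ρ') (hρ'per : ZdPeriodic ρ')
    (hρ'pos : ∀ y, 0 < ρ' y) {X' : ℝ → (Fin d → ℝ) → (Fin d → ℝ)}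
    (hX' : IsFlowOf (fun y => ρ' y • Φ y) X') {ζ' : Fin d → ℝ}
    (hζ' : rotationSet (fun y => ρ' y • Φ y) X' = {ζ'}) :
    ∫ y, ρ y • Φ y ∂μ = (∫ y, ρ y / ρ' y ∂μ) • ζ' := by
  set g := fun y => ρ y / ρ' y with hg
  have hgc : Continuous g := hρ.div hρ'.continuous fun y => (hρ'pos y).ne'
  have hgper : ZdPeriodic g := fun κ x => by simp only [hg, hρper κ x, hρ'per κ x]
  have hg0 : ∀ y, 0 ≤ g y := fun y => div_nonneg (hρ0 y) (hρ'pos y).le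
  have hgi : Integrable g μ := hgper.integrable hgc
  have hgρ : ∀ y, g y * ρ' y = ρ y := fun y => div_mul_cancel₀ _ (hρ'pos y).ne'
  set q := ∫ y, g y ∂μ with hq
  have hqn : 0 ≤ q := integral_nonneg hg0
  rcases hqn.eq_or_lt with hq0 | hq0
  · have hae : ∀ᵐ y ∂μ, ρ y • Φ y = 0 := by
      filter_upwards [(integral_eq_zero_iff_of_nonneg hg0 hgi).1 hq0.symm] with y hy
      rw [← hgρ y, hy, Pi.zero_apply, zero_mul, zero_smul]
    rw [integral_congr_ae hae, ← hq0]
    simp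
  set ν := ENNReal.ofReal q⁻¹ • μ.withDensity fun y => ENNReal.ofReal (g y) with hν
  have hint : ∀ {E : Type} [NormedAddCommGroup E] [NormedSpace ℝ E] (f : (Fin d → ℝ) → E),
      ∫ y, f y ∂ν = q⁻¹ • ∫ y, g y • f y ∂μ := by
    intro E _ _ f
    rw [hν, integral_smul_measure, integral_withDensity_eq_integral_toReal_smul
      hgc.measurable.ennreal_ofReal (.of_forall fun _ => ENNReal.ofReal_lt_top),
      ENNReal.toReal_ofReal (inv_nonneg.2 hq0.le)]
    simp only [ENNReal.toReal_ofReal (hg0 _)]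
  have hνprob : IsProbabilityMeasure ν := by
    refine ⟨?_⟩
    rw [hν, Measure.smul_apply, withDensity_apply _ MeasurableSet.univ, Measure.restrict_univ,
      ← ofReal_integral_eq_lintegral_ofReal hgi (.of_forall hg0), smul_eq_mul,
      ← ENNReal.ofReal_mul (inv_nonneg.2 hq0.le), ← hq, inv_mul_cancel₀ hq0.ne',
      ENNReal.ofReal_one]
  have hνc : ν (unitCube d)ᶜ = 0 := by
    rw [hν, Measure.smul_apply, withDensity_absolutelyContinuous _ _ hc, smul_zero]
  have hb' : ContDiff ℝ 1 fun y => ρ' y • Φ y := hρ'.smul hΦ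
  have hmem : ∫ y, ρ' y • Φ y ∂ν ∈ rotationSet (fun y => ρ' y • Φ y) X' := by
    refine (mem_rotationSet_iff hb'
      (fun κ x => by simp only [hρ'per κ x, hΦper κ x]) hX').2
      ⟨ν, hνprob, hνc, fun ψ hψ hψper => ?_, rfl⟩
    rw [hint, ← smul_zero q⁻¹, ← hμ ψ hψ hψper]
    simp only [map_smul, smul_smul, hgρ]
  rw [hζ', Set.mem_singleton_iff, hint] at hmem
  simp only [smul_smul, hgρ] at hmem
  rw [← hmem, smul_inv_smul₀ hq0.ne']

lemma tendsto_integral_div [IsProbabilityMeasure μ] (hρ : Continuous ρ) (hρ0 : ∀ y, 0 ≤ ρ y)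
    {ρn : ℕ → (Fin d → ℝ) → ℝ} (hρn : ∀ n, Continuous (ρn n)) (hρnpos : ∀ n y, 0 < ρn n y)
    (hle : ∀ n y, ρ y ≤ ρn n y) (hlim : ∀ y, Tendsto (fun n => ρn n y) atTop (nhds (ρ y))) :
    Tendsto (fun n => ∫ y, ρ y / ρn n y ∂μ) atTop (nhds (∫ y, ρ y / ρ y ∂μ)) := by
  refine tendsto_integral_of_dominated_convergence (fun _ => (1 : ℝ))
    (fun n => (hρ.div (hρn n) fun y => (hρnpos n y).ne').aestronglyMeasurable)
    (integrable_const _) (fun n => .of_forall fun y => ?_) (.of_forall fun y => ?_)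
  · rw [Real.norm_of_nonneg (div_nonneg (hρ0 y) (hρnpos n y).le)]
    exact div_le_one_of_le₀ (hle n y) (hρnpos n y).le
  · rcases eq_or_ne (ρ y) 0 with h | h
    · simp [h]
    · exact tendsto_const_nhds.div (hlim y) h

lemma exists_weaklyDivFree_measure (hd : 1 ≤ d)
    (hρ : ContDiff ℝ 1 ρ) (hρ0 : ∀ y, 0 ≤ ρ y) (hΦ : ContDiff ℝ 1 Φ) (hΦper : ZdPeriodic Φ)
    {σ : (Fin d → ℝ) → ℝ} (hσ : ContDiff ℝ 1 σ) (hσper : ZdPeriodic σ) (hσpos : ∀ y, 0 < σ y)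
    (hdiv : ∀ y : Fin d → ℝ,
      ∑ i : Fin d, fderiv ℝ (fun z => σ z * Φ z i) y (Pi.single i 1) = 0)
    {m : ℝ}
    (hm : m = ((∫⁻ y in unitCube d,
        ENNReal.ofReal (σ y) / ENNReal.ofReal (ρ y)).toReal)⁻¹)
    (hmpos : 0 < m) :
    ∃ μ : Measure (Fin d → ℝ), IsProbabilityMeasure μ ∧ μ (unitCube d)ᶜ = 0 ∧
      WeaklyDivFree (fun y => ρ y • Φ y) μ ∧ (∀ᵐ y ∂μ, ρ y ≠ 0) ∧
      ∫ y, ρ y • Φ y ∂μ = m • ∫ y in unitCube d, σ y • Φ y := by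
  set g : (Fin d → ℝ) → ENNReal := fun y => ENNReal.ofReal (σ y) / ENNReal.ofReal (ρ y) with hg
  have hgm : Measurable g :=
    hσ.continuous.measurable.ennreal_ofReal.div hρ.continuous.measurable.ennreal_ofReal
  set I := ∫⁻ y in unitCube d, g y with hI
  obtain ⟨hI0, hItop⟩ : 0 < I ∧ I < ⊤ := by
    rw [← ENNReal.toReal_pos_iff]
    rwa [hm, inv_pos] at hmpos
  have hgtop : ∀ᵐ y ∂volume.restrict (unitCube d), g y < ⊤ := ae_lt_top hgm hItop.ne
  have hρae : ∀ᵐ y ∂volume.restrict (unitCube d), ρ y ≠ 0 := by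
    filter_upwards [hgtop] with y hy h0
    simp only [hg, h0, ENNReal.ofReal_zero] at hy
    rw [ENNReal.div_zero (by simpa using hσpos y)] at hy
    exact lt_irrefl _ hy
  set μ := I⁻¹ • (volume.restrict (unitCube d)).withDensity g with hμ
  have hac : μ ≪ volume.restrict (unitCube d) :=
    (withDensity_absolutelyContinuous _ _).smul_left _
  have hint : ∀ {E : Type} [NormedAddCommGroup E] [NormedSpace ℝ E] (f : (Fin d → ℝ) → E),
      ∫ y, ρ y • f y ∂μ = m • ∫ y in unitCube d, σ y • f y := by
    intro E _ _ f
    rw [hμ, integral_smul_measure, integral_withDensity_eq_integral_toReal_smul hgm hgtop,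
      ENNReal.toReal_inv, ← hm]
    congr 1
    refine integral_congr_ae ?_
    filter_upwards [hρae] with y hy
    rw [smul_smul, hg, ENNReal.toReal_div, ENNReal.toReal_ofReal (hσpos y).le,
      ENNReal.toReal_ofReal (hρ0 y), div_mul_cancel₀ _ hy]
  refine ⟨μ, ⟨?_⟩, ?_, fun ψ hψ hψper => ?_, hac hρae, hint Φ⟩
  · rw [hμ, Measure.smul_apply, withDensity_apply _ MeasurableSet.univ, Measure.restrict_univ,
      ← hI, smul_eq_mul, ENNReal.inv_mul_cancel hI0.ne' hItop.ne]
  · refine hac ?_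
    rw [Measure.restrict_apply measurableSet_unitCube.compl, Set.compl_inter_self, measure_empty]
  · simp only [map_smul]
    rw [hint]
    simp only [smul_eq_mul]
    rw [integral_unitCube_fderiv_smul_eq_zero hd hΦ hΦper hσ hσper hdiv hψ hψper, mul_zero]

end RotationSet

/-- In the setting of the perturbation theorem (with `ρ` vanishing
somewhere), if there is a positive `σ ∈ C¹_♯(Y_d)` with `σΦ` divergence free in `ℝ^d` and the
harmonic mean `m = (∫_{Y_d} σ/ρ dy)⁻¹` of `ρ/σ` is positive, then
`C_b = [0,ζ]` with `ζ = m ∫_{Y_d} Φσ dy`. -/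
theorem rotationSet_segment_positive_harmonic_mean {d : ℕ} (hd : 1 ≤ d)
    (ρ : (Fin d → ℝ) → ℝ) (hρ : ContDiff ℝ 1 ρ) (hρper : ZdPeriodic ρ)
    (hρ0 : ∀ y, 0 ≤ ρ y) (hρne : ∃ y, ρ y ≠ 0)
    (Φ : (Fin d → ℝ) → (Fin d → ℝ)) (hΦ : ContDiff ℝ 1 Φ) (hΦper : ZdPeriodic Φ)
    (hΦne : ∀ y, Φ y ≠ 0)
    (X : ℝ → (Fin d → ℝ) → (Fin d → ℝ)) (hX : IsFlowOf (fun y => ρ y • Φ y) X)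
    (ρn : ℕ → (Fin d → ℝ) → ℝ)
    (hρn : ∀ n, ContDiff ℝ 1 (ρn n)) (hρnper : ∀ n, ZdPeriodic (ρn n))
    (hρnpos : ∀ n y, 0 < ρn n y) (hle : ∀ n y, ρ y ≤ ρn n y)
    (hunif : TendstoUniformly ρn ρ atTop)
    (Xn : ℕ → ℝ → (Fin d → ℝ) → (Fin d → ℝ))
    (hXn : ∀ n, IsFlowOf (fun y => ρn n y • Φ y) (Xn n))
    (hsin : ∀ n, ∃ ζ : Fin d → ℝ, rotationSet (fun y => ρn n y • Φ y) (Xn n) = {ζ})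
    (hvan : ∃ x₀, ρ x₀ = 0)
    (σ : (Fin d → ℝ) → ℝ) (hσ : ContDiff ℝ 1 σ) (hσper : ZdPeriodic σ) (hσpos : ∀ y, 0 < σ y)
    (hdiv : ∀ y : Fin d → ℝ,
      ∑ i : Fin d, fderiv ℝ (fun z => σ z * Φ z i) y (Pi.single i 1) = 0)
    (m : ℝ)
    (hm : m = ((∫⁻ y in unitCube d,
        ENNReal.ofReal (σ y) / ENNReal.ofReal (ρ y)).toReal)⁻¹)
    (hmpos : 0 < m)
    (ζ : Fin d → ℝ) (hζ : ζ = m • ∫ y in unitCube d, σ y • Φ y) :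
    rotationSet (fun y => ρ y • Φ y) X = segment ℝ 0 ζ := by
  have hb : ContDiff ℝ 1 fun y => ρ y • Φ y := hρ.smul hΦ
  have hper : ZdPeriodic fun y => ρ y • Φ y := fun κ x => by simp only [hρper κ x, hΦper κ x]
  choose ζn hζn using hsin
  have htime : ∀ ν : Measure (Fin d → ℝ), IsProbabilityMeasure ν → ν (unitCube d)ᶜ = 0 →
      WeaklyDivFree (fun y => ρ y • Φ y) ν → ∀ n,
      ∫ y, ρ y • Φ y ∂ν = (∫ y, ρ y / ρn n y ∂ν) • ζn n := fun ν _ hνc hν n =>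
    integral_eq_smul_of_rotationSet_eq_singleton hνc hρ.continuous hρper hρ0 hΦ hΦper hν
      (hρn n) (hρnper n) (hρnpos n) (hXn n) (hζn n)
  have hratio : ∀ ν : Measure (Fin d → ℝ), IsProbabilityMeasure ν →
      Tendsto (fun n => ∫ y, ρ y / ρn n y ∂ν) atTop (nhds (∫ y, ρ y / ρ y ∂ν)) := fun ν _ =>
    tendsto_integral_div hρ.continuous hρ0 (fun n => (hρn n).continuous) hρnpos hle
      fun y => hunif.tendsto_at y
  obtain ⟨μ, hμ, hμc, hμd, hμρ, hμζ⟩ := exists_weaklyDivFree_measure hd hρ hρ0 hΦ hΦper hσ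
    hσper hσpos hdiv hm hmpos
  rw [← hζ] at hμζ
  have hone : ∫ y, ρ y / ρ y ∂μ = 1 := by
    rw [integral_congr_ae (g := fun _ => (1 : ℝ))
      (by filter_upwards [hμρ] with y hy using div_self hy)]
    simp
  have hζlim : Tendsto ζn atTop (nhds ζ) := by
    have h1 := hratio μ hμ
    rw [hone] at h1
    have h2 : Tendsto (fun n => (∫ y, ρ y / ρn n y ∂μ)⁻¹ • ζ) atTop (nhds ((1 : ℝ)⁻¹ • ζ)) :=
      (h1.inv₀ one_ne_zero).smul_const ζ
    rw [inv_one, one_smul] at h2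
    refine h2.congr' ?_
    filter_upwards [h1.eventually_ne one_ne_zero] with n hn
    rw [← hμζ, htime μ hμ hμc hμd n, inv_smul_smul₀ hn]
  refine Set.Subset.antisymm (fun ξ hξ => ?_) ?_
  · obtain ⟨ν, hν, hνc, hνd, rfl⟩ := (mem_rotationSet_iff hb hper hX).1 hξ
    have hξ : ∫ y, ρ y • Φ y ∂ν = (∫ y, ρ y / ρ y ∂ν) • ζ := by
      refine tendsto_nhds_unique (tendsto_const_nhds (f := (atTop : Filter ℕ)))
        (((hratio ν hν).smul hζlim).congr fun n => (htime ν hν hνc hνd n).symm)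
    rw [hξ, segment_eq_image]
    have h01 : ∀ y, 0 ≤ ρ y / ρ y ∧ ρ y / ρ y ≤ 1 := fun y =>
      ⟨div_nonneg (hρ0 y) (hρ0 y), div_self_le_one _⟩
    refine ⟨∫ y, ρ y / ρ y ∂ν, ⟨integral_nonneg fun y => (h01 y).1, ?_⟩, by simp⟩
    have := integral_mono_of_nonneg (μ := ν) (.of_forall fun y => (h01 y).1)
      (integrable_const (1 : ℝ)) (.of_forall fun y => (h01 y).2)
    simpa using this
  · refine (convex_rotationSet hb hper hX).segment_subset
      (zero_mem_rotationSet hb hper hX ?_)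
      ((mem_rotationSet_iff hb hper hX).2 ⟨μ, hμ, hμc, hμd, hμζ.symm⟩)
    obtain ⟨x₀, hx₀⟩ := hvan
    exact ⟨x₀, by simp [hx₀]⟩
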